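/- Let F be a finite group with at least two elements, let G = ℤ ≀ F be the wreath product, let μ be the standard simple switch-walk-switch measure on G, let S be the standard generating set of G, and let G₀ = ⊕_{ℤ}F ⊆ G be the subgroup of elements with trivial ℤ-coordinate. For every ε > 0 there exists c > 0 such that for all sufficiently large n there is a subset V_n ⊆ G with μ^{*n}(V_n) ≥ 1 − ε and, for every h ∈ V_n and every g ∈ G₀ with l_S(g) ≤ c·√n, μ^{*n}(h·g) = μ^{*n}(h). -/

import Mathlib

noncomputable section
open Filter
open scoped Classical

/-- Convolution of two measures (as real-valued functions) on a group:
`(μ * ν)(g) = Σ_h μ(h) ν(h⁻¹ g)`. -/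
def conv {G : Type*} [Group G] (μ ν : G → ℝ) : G → ℝ :=
  fun g => ∑' h : G, μ h * ν (h⁻¹ * g)

/-- `n`-fold convolution power; `convPow μ 0` is the point mass at the identity. -/
def convPow {G : Type*} [Group G] (μ : G → ℝ) : ℕ → G → ℝ
  | 0 => fun g => if g = 1 then 1 else 0
  | n + 1 => conv μ (convPow μ n)

/-- Measure of a subset: `μ(A) = Σ_{x ∈ A} μ(x)`. -/
def measOf {G : Type*} (μ : G → ℝ) (A : Set G) : ℝ := ∑' x : A, μ x

/-- Word length of `g` with respect to `S ∪ S⁻¹`: the least `k` such that `g` is a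
product of `k` elements of `S ∪ S⁻¹`. -/
def wordLength {G : Type*} [Group G] (S : Set G) (g : G) : ℕ :=
  sInf {k | ∃ l : List G, l.length = k ∧ (∀ x ∈ l, x ∈ S ∨ x⁻¹ ∈ S) ∧ l.prod = g}

/-- The group of finitely supported functions `A → F` (pointwise multiplication), as a
subgroup of the product group. -/
def FinMulSupp (A : Type*) (F : Type*) [Group F] : Subgroup (A → F) where
  carrier := {f | (Function.mulSupport f).Finite}
  one_mem' := by simp [Function.mulSupport_one]
  mul_mem' := by
    intro f g hf hg
    exact (hf.union hg).subset (Function.mulSupport_mul f g)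
  inv_mem' := by
    intro f hf
    simpa [Function.mulSupport_inv] using hf

/-- The shift automorphism of `FinMulSupp A F` associated to `z : A`:
`(z · f)(x) = f(x - z)`. -/
def shiftEquiv {A : Type*} [AddCommGroup A] {F : Type*} [Group F] (z : A) :
    FinMulSupp A F ≃* FinMulSupp A F where
  toFun f := ⟨fun x => f.1 (x - z), by
    refine (f.2.image (fun y => y + z)).subset ?_
    intro x hx
    exact ⟨x - z, hx, by simp⟩⟩
  invFun f := ⟨fun x => f.1 (x + z), by
    refine (f.2.image (fun y => y - z)).subset ?_
    intro x hx
    exact ⟨x + z, hx, by simp⟩⟩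
  left_inv f := by
    apply Subtype.ext
    funext x
    simp
  right_inv f := by
    apply Subtype.ext
    funext x
    simp
  map_mul' f g := rfl

/-- The shift action of `A` on `FinMulSupp A F`, as a homomorphism
`Multiplicative A →* MulAut (FinMulSupp A F)`. -/
def shiftHom (A : Type*) [AddCommGroup A] (F : Type*) [Group F] :
    Multiplicative A →* MulAut (FinMulSupp A F) where
  toFun z := shiftEquiv (Multiplicative.toAdd z)
  map_one' := by
    apply MulEquiv.ext
    intro f
    apply Subtype.ext
    funext x
    simp [shiftEquiv]
  map_mul' z w := by
    apply MulEquiv.ext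
    intro f
    apply Subtype.ext
    funext x
    simp [shiftEquiv, MulAut.mul_apply, sub_sub]

/-- The wreath product `A ≀ F` (with acting group `A`): the semidirect product of the group
of finitely supported functions `A → F` with `A` acting by shifts. -/
abbrev Wreath (A : Type*) [AddCommGroup A] (F : Type*) [Group F] : Type _ :=
  FinMulSupp A F ⋊[shiftHom A F] Multiplicative A

/-- The function supported at `0 : A` with value `f` there. -/
def deltaF {A : Type*} [AddCommGroup A] {F : Type*} [Group F] (f : F) : FinMulSupp A F :=
  ⟨fun x => if x = 0 then f else 1, by
    refine (Set.finite_singleton (0 : A)).subset ?_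
    intro x hx
    by_contra hx0
    simp only [Function.mem_mulSupport] at hx
    simp only [Set.mem_singleton_iff] at hx0
    simp [hx0] at hx⟩

/-- The measure on the wreath product carried by the `A`-factor, induced by `ν : A → ℝ`. -/
def liftA {A : Type*} [AddCommGroup A] {F : Type*} [Group F] (ν : A → ℝ) :
    Wreath A F → ℝ :=
  fun g => if g.left = 1 then ν (Multiplicative.toAdd g.right) else 0

/-- The uniform measure on the copy of `F` at coordinate `0 : A`. -/
def unifF (A : Type*) [AddCommGroup A] (F : Type*) [Group F] [Fintype F] :
    Wreath A F → ℝ :=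
  Set.indicator {g : Wreath A F | ∃ f : F, g = SemidirectProduct.inl (deltaF f)}
    (fun _ => (Fintype.card F : ℝ)⁻¹)

/-- The switch-walk-switch measure `μ = μ_B * μ_A * μ_B` on the wreath product, where
`μ_A` is the lift of `ν` to the `A`-factor and `μ_B` is uniform on the copy of `F` at
coordinate `0`. -/
def swsMeasure {A : Type*} [AddCommGroup A] {F : Type*} [Group F] [Fintype F]
    (ν : A → ℝ) : Wreath A F → ℝ :=
  conv (unifF A F) (conv (liftA ν) (unifF A F))

/-- The standard generating set of `ℤ ≀ F`: the elements `(±1, e)` together with the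
elements `(0, f·δ₀)` for `f ∈ F`. -/
def stdGenZ (F : Type*) [Group F] : Set (Wreath ℤ F) :=
  {g | g = SemidirectProduct.inr (Multiplicative.ofAdd (1 : ℤ)) ∨
       g = SemidirectProduct.inr (Multiplicative.ofAdd (-1 : ℤ))} ∪
  {g | ∃ f : F, g = SemidirectProduct.inl (deltaF f)}


/-- State of the walk seen from the end point: lowest, current, highest site. -/
structure WSt where
  lo : ℤ
  y : ℤ
  hi : ℤ
  h1 : lo ≤ y
  h2 : y ≤ hi

def wstep (s : ℤ) (st : WSt) : WSt :=
  ⟨min st.lo (st.y - s), st.y - s, max st.hi (st.y - s), min_le_right _ _, le_max_right _ _⟩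

def winit : WSt := ⟨0, 0, 0, le_rfl, le_rfl⟩

def stepSet : Finset ℤ := {-1, 0, 1}

def Qop (ν : ℤ → ℝ) (H : WSt → ℝ) : WSt → ℝ :=
  fun st => ∑ s ∈ stepSet, ν s * H (wstep s st)

lemma Qop_mono {ν : ℤ → ℝ} (h0 : ∀ z, 0 ≤ ν z) {H H' : WSt → ℝ} (h : ∀ st, H st ≤ H' st)
    (n : ℕ) : ∀ st, (Qop ν)^[n] H st ≤ (Qop ν)^[n] H' st := by
  induction n with
  | zero => simpa using h
  | succ n ih =>
    intro st
    rw [Function.iterate_succ_apply', Function.iterate_succ_apply']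
    exact Finset.sum_le_sum fun s _ => mul_le_mul_of_nonneg_left (ih _) (h0 s)

lemma Qop_sum {ν : ℤ → ℝ} {ι : Type*} (t : Finset ι) (w : ι → ℝ) (H : ι → WSt → ℝ)
    (n : ℕ) : ∀ st, (Qop ν)^[n] (fun st => ∑ i ∈ t, w i * H i st) st
      = ∑ i ∈ t, w i * (Qop ν)^[n] (H i) st := by
  induction n with
  | zero => simp
  | succ n ih =>
    intro st
    simp only [Function.iterate_succ_apply']
    simp only [Qop, ih, Finset.mul_sum]
    rw [Finset.sum_comm]
    exact Finset.sum_congr rfl fun i _ => Finset.sum_congr rfl fun s _ => by ring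

lemma Qop_sub {ν : ℤ → ℝ} (H H' : WSt → ℝ)
    (n : ℕ) : ∀ st, (Qop ν)^[n] (fun st => H st - H' st) st
      = (Qop ν)^[n] H st - (Qop ν)^[n] H' st := by
  induction n with
  | zero => simp
  | succ n ih =>
    intro st
    simp only [Function.iterate_succ_apply']
    simp only [Qop, ih, mul_sub, Finset.sum_sub_distrib]

lemma Qop_const {ν : ℤ → ℝ} (h : ∑ s ∈ stepSet, ν s = 1) (c : ℝ)
    (n : ℕ) : ∀ st, (Qop ν)^[n] (fun _ => c) st = c := by
  induction n with
  | zero => simp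
  | succ n ih =>
    intro st
    simp only [Function.iterate_succ_apply']
    simp only [Qop, ih, ← Finset.sum_mul, h, one_mul]

lemma Qop_hasSum {ν : ℤ → ℝ} {α : Type*} (K : WSt → α → ℝ) (k : WSt → ℝ)
    (h : ∀ st, HasSum (K st) (k st))
    (n : ℕ) : ∀ st, HasSum (fun x => (Qop ν)^[n] (fun st => K st x) st) ((Qop ν)^[n] k st) := by
  induction n with
  | zero => simpa using h
  | succ n ih =>
    intro st
    simp only [Function.iterate_succ_apply']
    simp only [Qop]
    exact hasSum_sum fun s _ => (ih _).mul_left _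

/-- Hitting estimate. -/
lemma Qop_hit {ν : ℤ → ℝ} (h0 : ∀ z, 0 ≤ ν z) (h1 : ∑ s ∈ stepSet, ν s = 1)
    (hsym : ν (-1) = ν 1) (A : WSt → Prop) [DecidablePred A] (Z : WSt → ℤ) (m : ℤ) (σ : ℤ) (hσ : σ = 1 ∨ σ = -1)
    (hZ : ∀ s st, Z (wstep s st) = Z st + σ * s)
    (hA : ∀ s st, A (wstep s st) → A st) (hAm : ∀ st, A st → Z st < m)
    (θ ρ : ℝ) (hρ : ρ = 1 + ν 1 * (Real.exp θ + Real.exp (-θ) - 2)) (hρ1 : 1 ≤ ρ) (hθ : 0 ≤ θ)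
    (N n : ℕ) (hn : n ≤ N) : ∀ st, Z st ≤ m →
      (1 - (ρ ^ N)⁻¹) * (Qop ν)^[n] (fun st => if A st then 1 else 0) st ≤
        1 - Real.exp (-θ * (m - Z st)) * (ρ ^ (N - n))⁻¹ := by
  have hz : ∀ n st, ¬ A st → (Qop ν)^[n] (fun st => if A st then (1:ℝ) else 0) st = 0 := by
    intro n
    induction n with
    | zero => intro st h; simp [h]
    | succ n ih =>
      intro st h
      simp only [Function.iterate_succ_apply']
      exact Finset.sum_eq_zero fun s _ => by rw [ih _ (fun h' => h (hA _ _ h')), mul_zero]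
  have hinv : ∀ k : ℕ, (ρ ^ k)⁻¹ ≤ 1 := fun k => inv_le_one_of_one_le₀ (one_le_pow₀ hρ1)
  have hinv0 : ∀ k : ℕ, 0 ≤ (ρ ^ k)⁻¹ := fun k => inv_nonneg.2 (by positivity)
  have hrhs : ∀ st, Z st ≤ m → ∀ k : ℕ, Real.exp (-θ * (m - Z st)) * (ρ ^ k)⁻¹ ≤ 1 := by
    intro st hst k
    have : (Z st : ℝ) ≤ m := by exact_mod_cast hst
    have : Real.exp (-θ * (m - Z st)) ≤ 1 := Real.exp_le_one_iff.2 (by nlinarith)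
    exact mul_le_one₀ this (hinv0 k) (hinv k)
  induction n with
  | zero =>
    intro st hst
    by_cases h : A st
    · have : (Z st : ℝ) ≤ m := by exact_mod_cast hst
      have : Real.exp (-θ * (m - Z st)) ≤ 1 := Real.exp_le_one_iff.2 (by nlinarith)
      have := hinv0 N
      simp only [Function.iterate_zero, id, if_pos h, Nat.sub_zero]
      nlinarith
    · have := hrhs st hst N
      simp [h]
      simpa using this
  | succ n ih =>
    intro st hst
    by_cases h : A st
    · have hlt := hAm st h
      have ih := ih (by omega)
      have hb : ∀ s ∈ stepSet, Z (wstep s st) ≤ m := by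
        intro s hs
        rw [hZ]
        simp only [stepSet, Finset.mem_insert, Finset.mem_singleton] at hs
        rcases hσ with rfl | rfl <;> omega
      have key : (1 - (ρ ^ N)⁻¹) * Qop ν ((Qop ν)^[n] (fun st => if A st then 1 else 0)) st ≤
          ∑ s ∈ stepSet, ν s * (1 - Real.exp (-θ * (m - Z (wstep s st))) * (ρ ^ (N - n))⁻¹) := by
        rw [Qop, Finset.mul_sum]
        refine Finset.sum_le_sum fun s hs => ?_
        have := mul_le_mul_of_nonneg_left (ih _ (hb s hs)) (h0 s)
        linarith
      rw [Function.iterate_succ_apply']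
      refine key.trans (le_of_eq ?_)
      have hexp : ∀ k : ℤ, Real.exp (-θ * (m - ((Z st + k : ℤ) : ℝ))) =
          Real.exp (-θ * (m - Z st)) * Real.exp (θ * k) := by
        intro k; rw [← Real.exp_add]; push_cast; ring_nf
      have hN : N - n = (N - (n+1)) + 1 := by omega
      rw [hN, pow_succ, mul_inv]
      have hρ0 : ρ ≠ 0 := by linarith
      have h1' : ν 0 = 1 - 2 * ν 1 := by
        simp [stepSet, hsym] at h1; linarith
      have hfin : ∑ s ∈ stepSet, ν s * Real.exp (-θ * (m - Z (wstep s st))) =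
          ρ * Real.exp (-θ * (m - Z st)) := by
        simp only [hZ, hexp, hρ]
        rcases hσ with rfl | rfl <;> simp [stepSet, hsym, h1'] <;> ring
      have hsplit : ∀ (E : ℤ → ℝ) (c : ℝ), ∑ s ∈ stepSet, ν s * (1 - E s * c) =
          ∑ s ∈ stepSet, ν s - (∑ s ∈ stepSet, ν s * E s) * c := by
        intro E c
        rw [Finset.sum_mul, ← Finset.sum_sub_distrib]
        exact Finset.sum_congr rfl fun s _ => by ring
      rw [hsplit (fun s => Real.exp (-θ * (m - Z (wstep s st)))), hfin, h1]
      field_simp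
    · rw [hz _ _ h, mul_zero]
      linarith [hrhs st hst (N - (n+1))]

/-- Numerical form of the hitting estimate. -/
lemma Qop_hit' {ν : ℤ → ℝ} (h0 : ∀ z, 0 ≤ ν z) (h1 : ∑ s ∈ stepSet, ν s = 1)
    (hsym : ν (-1) = ν 1) (A : WSt → Prop) [DecidablePred A] (Z : WSt → ℤ) (m : ℕ) (σ : ℤ) (hσ : σ = 1 ∨ σ = -1)
    (hZ : ∀ s st, Z (wstep s st) = Z st + σ * s)
    (hA : ∀ s st, A (wstep s st) → A st) (hAm : ∀ st, A st → Z st < m) (hZ0 : Z winit = 0)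
    (θ : ℝ) (hθ : 0 ≤ θ) (n : ℕ) :
      (Qop ν)^[n] (fun st => if A st then 1 else 0) winit ≤
        θ * m + (1 + n * (ν 1 * (θ ^ 2 / 2)))⁻¹ := by
  set u := (Qop ν)^[n] (fun st => if A st then (1:ℝ) else 0) winit with hu
  have hu1 : u ≤ 1 := by
    rw [← Qop_const h1 1 n winit]
    exact Qop_mono h0 (fun st => by split_ifs <;> norm_num) n _
  set ρ := 1 + ν 1 * (Real.exp θ + Real.exp (-θ) - 2) with hρ
  have hge : ν 1 * (θ ^ 2 / 2) ≤ ν 1 * (Real.exp θ + Real.exp (-θ) - 2) := by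
    apply mul_le_mul_of_nonneg_left _ (h0 1)
    have a := Real.quadratic_le_exp_of_nonneg hθ
    have b := Real.add_one_le_exp (-θ)
    linarith
  have hx0 : 0 ≤ ν 1 * (θ ^ 2 / 2) := mul_nonneg (h0 1) (by positivity)
  have hρ1 : 1 ≤ ρ := by linarith
  have main := Qop_hit h0 h1 hsym A Z m σ hσ hZ hA hAm θ ρ hρ hρ1 hθ n n le_rfl winit
    (by rw [hZ0]; positivity)
  rw [hZ0, ← hu] at main
  simp only [Nat.sub_self, pow_zero, inv_one, mul_one, Int.cast_zero, sub_zero, Int.cast_natCast]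
    at main
  have e := Real.add_one_le_exp (-θ * m)
  have hpow : 1 + n * (ν 1 * (θ ^ 2 / 2)) ≤ ρ ^ n := by
    refine (one_add_mul_le_pow (by linarith) n).trans (pow_le_pow_left₀ (by linarith) (by linarith) n)
  have hinv : (ρ ^ n)⁻¹ ≤ (1 + n * (ν 1 * (θ ^ 2 / 2)))⁻¹ := by
    apply inv_anti₀ (by positivity) hpow
  have : 0 ≤ (ρ ^ n)⁻¹ := inv_nonneg.2 (by positivity)
  nlinarith

section WreathPart
variable {F : Type*} [Group F]

lemma wr_mul_left (g h : Wreath ℤ F) (b : ℤ) :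
    (g * h).left.1 b = g.left.1 b * h.left.1 (b - Multiplicative.toAdd g.right) := rfl

lemma wr_inv_left (g : Wreath ℤ F) (b : ℤ) :
    (g⁻¹).left.1 b = (g.left.1 (b + Multiplicative.toAdd g.right))⁻¹ := by
  rw [SemidirectProduct.inv_left]
  change (g.left⁻¹).1 (b - Multiplicative.toAdd g.right⁻¹) = _
  simp

lemma wr_ext {g h : Wreath ℤ F} (h1 : ∀ b, g.left.1 b = h.left.1 b)
    (h2 : Multiplicative.toAdd g.right = Multiplicative.toAdd h.right) : g = h := by
  apply SemidirectProduct.ext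
  · apply Subtype.ext
    funext b
    exact h1 b
  · exact h2

lemma deltaF_apply (f : F) (b : ℤ) : (deltaF f : FinMulSupp ℤ F).1 b = if b = 0 then f else 1 := by
  by_cases h : b = 0 <;> simp [deltaF, h]

lemma one_left_apply (b : ℤ) : (1 : FinMulSupp ℤ F).1 b = 1 := rfl

/-- generators -/
lemma gen_supp (l : List (Wreath ℤ F)) (hl : ∀ x ∈ l, x ∈ stdGenZ F ∨ x⁻¹ ∈ stdGenZ F) :
    ∀ b : ℤ, l.prod.left.1 b ≠ 1 → |b| ≤ l.length := by
  induction l with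
  | nil => intro b hb; exact absurd rfl hb
  | cons x l ih =>
    intro b hb
    have ih := ih (fun y hy => hl y (List.mem_cons_of_mem _ hy))
    rw [List.prod_cons, wr_mul_left] at hb
    have hx : (|Multiplicative.toAdd x.right| ≤ 1) ∧
        (∀ b, x.left.1 b ≠ 1 → b = 0) := by
      have base : ∀ x ∈ stdGenZ F, (|Multiplicative.toAdd x.right| ≤ 1) ∧
        (∀ b, x.left.1 b ≠ 1 → b = 0 ∧ Multiplicative.toAdd x.right = 0) := by
        rintro x ((rfl | rfl) | ⟨f, rfl⟩)
        · exact ⟨by simp, fun b hb => absurd rfl hb⟩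
        · exact ⟨by simp, fun b hb => absurd rfl hb⟩
        · refine ⟨by simp, fun b hb => ⟨?_, by simp⟩⟩
          by_contra hb0
          exact hb (by rw [SemidirectProduct.left_inl, deltaF_apply, if_neg hb0])
      rcases hl x List.mem_cons_self with h | h
      · exact ⟨(base x h).1, fun b hb => ((base x h).2 b hb).1⟩
      · have := base _ h
        refine ⟨?_, fun b hb => ?_⟩
        · have h1 := this.1
          rw [SemidirectProduct.inv_right, toAdd_inv, abs_neg] at h1
          exact h1
        · have h2 := this.2 (b - Multiplicative.toAdd x.right)
          rw [wr_inv_left, sub_add_cancel, SemidirectProduct.inv_right, toAdd_inv] at h2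
          have := h2 (by simpa using hb)
          omega
    by_cases h1 : x.left.1 b = 1
    · rw [h1, one_mul] at hb
      have := ih _ hb
      have h3 := hx.1
      rw [List.length_cons]
      push_cast
      rw [abs_le] at *
      omega
    · have := hx.2 b h1
      subst this
      simp
      positivity

lemma gen_closure : Subgroup.closure (stdGenZ F) = ⊤ := by
  set C := Subgroup.closure (stdGenZ F) with hC
  have hgen : (SemidirectProduct.inr (Multiplicative.ofAdd (1 : ℤ)) : Wreath ℤ F) ∈ C :=
    Subgroup.subset_closure (Or.inl (Or.inl rfl))
  have hinr : ∀ z : Multiplicative ℤ, (SemidirectProduct.inr z : Wreath ℤ F) ∈ C := by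
    intro z
    have : (SemidirectProduct.inr z : Wreath ℤ F) =
        (SemidirectProduct.inr (Multiplicative.ofAdd (1 : ℤ))) ^ (Multiplicative.toAdd z) := by
      rw [← map_zpow, ← ofAdd_zsmul]; simp
    rw [this]
    exact Subgroup.zpow_mem _ hgen _
  have hinl : ∀ (t : Finset ℤ) (f : FinMulSupp ℤ F), (∀ b, f.1 b ≠ 1 → b ∈ t) →
      (SemidirectProduct.inl f : Wreath ℤ F) ∈ C := by
    intro t
    induction t using Finset.induction_on with
    | empty =>
      intro f hf
      have : f = 1 := by
        apply Subtype.ext; funext b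
        by_contra h
        simpa using hf b h
      rw [this, map_one]
      exact C.one_mem
    | insert a t ha ih =>
      intro f hf
      set d : Wreath ℤ F := SemidirectProduct.inr (Multiplicative.ofAdd a) *
        SemidirectProduct.inl (deltaF (f.1 a)) * SemidirectProduct.inr (Multiplicative.ofAdd (-a))
        with hd
      have hdC : d ∈ C := C.mul_mem (C.mul_mem (hinr _)
        (Subgroup.subset_closure (Or.inr ⟨_, rfl⟩))) (hinr _)
      have hdl : ∀ b, d.left.1 b = if b = a then f.1 a else 1 := by
        intro b
        rw [hd, wr_mul_left, wr_mul_left]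
        simp [one_left_apply, deltaF_apply, sub_eq_zero]
      have hdr : Multiplicative.toAdd d.right = 0 := by simp [hd]
      have hdi : SemidirectProduct.inl f = d * SemidirectProduct.inl (d.left⁻¹ * f) := by
        apply wr_ext
        · intro b
          rw [wr_mul_left, hdr]
          simp
        · simp [hdr]
      rw [hdi]
      refine C.mul_mem hdC (ih _ ?_)
      intro b hb
      have h2 : (d.left⁻¹ * f).1 b = (d.left.1 b)⁻¹ * f.1 b := rfl
      rw [h2, hdl] at hb
      by_cases hba : b = a
      · subst hba; simp at hb
      · have := hf b (by simpa [hba] using hb)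
        simpa [hba] using this
  rw [eq_top_iff]
  intro g _
  rw [← SemidirectProduct.inl_left_mul_inr_right g]
  exact C.mul_mem (hinl (Set.Finite.toFinset g.left.2) _ (fun b hb => (Set.Finite.mem_toFinset _).2 hb)) (hinr _)

lemma wl_supp (g : Wreath ℤ F) (b : ℤ) (hb : g.left.1 b ≠ 1) :
    |b| ≤ wordLength (stdGenZ F) g := by
  have hne : {k | ∃ l : List (Wreath ℤ F), l.length = k ∧
      (∀ x ∈ l, x ∈ stdGenZ F ∨ x⁻¹ ∈ stdGenZ F) ∧ l.prod = g}.Nonempty := by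
    have hg : g ∈ Subgroup.closure (stdGenZ F) := by rw [gen_closure]; trivial
    rw [← Subgroup.mem_toSubmonoid, Subgroup.closure_toSubmonoid] at hg
    obtain ⟨l, h1, h2⟩ := Submonoid.exists_list_of_mem_closure hg
    exact ⟨_, l, rfl, h1, h2⟩
  obtain ⟨l, h1, h2, h3⟩ := Nat.sInf_mem hne
  have := gen_supp l h2 b (by rw [h3]; exact hb)
  rw [h1] at this
  exact this

/-- uniform measure on lamp configurations with support in the range -/
def Uni (F : Type*) [Group F] [Fintype F] (st : WSt) : Wreath ℤ F → ℝ := fun g =>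
  if Multiplicative.toAdd g.right = -st.y ∧ ∀ b ∉ Finset.Icc st.lo st.hi, g.left.1 (b - st.y) = 1
  then ((Fintype.card F : ℝ)⁻¹) ^ (Finset.Icc st.lo st.hi).card else 0

variable [Fintype F]

lemma Uni_delta (st : WSt) (f : F) (g : Wreath ℤ F) :
    Uni F st ((SemidirectProduct.inl (deltaF f))⁻¹ * g) = Uni F st g := by
  have : (Multiplicative.toAdd ((SemidirectProduct.inl (deltaF f) : Wreath ℤ F)⁻¹ * g).right = -st.y ∧ ∀ b ∉ Finset.Icc st.lo st.hi, ((SemidirectProduct.inl (deltaF f) : Wreath ℤ F)⁻¹ * g).left.1 (b - st.y) = 1) ↔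
    (Multiplicative.toAdd g.right = -st.y ∧ ∀ b ∉ Finset.Icc st.lo st.hi, g.left.1 (b - st.y) = 1) := by
    apply and_congr
    · simp
    · refine forall₂_congr fun b hb => ?_
      have hby : b - st.y ≠ 0 := by
        have := st.h1
        have := st.h2
        simp only [Finset.mem_Icc, not_and_or] at hb
        omega
      rw [wr_mul_left, wr_inv_left]
      simp [deltaF_apply, hby]
  simp only [Uni, this]

lemma Uni_step (st : WSt) (s : ℤ) (hs : s ∈ stepSet) (g : Wreath ℤ F) :
    ∑ f : F, (Fintype.card F : ℝ)⁻¹ * Uni F st ((SemidirectProduct.inr (Multiplicative.ofAdd s))⁻¹ *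
      ((SemidirectProduct.inl (deltaF f))⁻¹ * g)) = Uni F (wstep s st) g := by
  have hcard : (Fintype.card F : ℝ) ≠ 0 := by
    exact_mod_cast Fintype.card_ne_zero
  have hI : Finset.Icc (wstep s st).lo (wstep s st).hi
      = insert (st.y - s) (Finset.Icc st.lo st.hi) := by
    have := st.h1
    have := st.h2
    simp only [stepSet, Finset.mem_insert, Finset.mem_singleton] at hs
    ext b
    simp only [wstep, Finset.mem_Icc, Finset.mem_insert]
    omega
  have hcond : ∀ f : F, (Multiplicative.toAdd ((SemidirectProduct.inr (Multiplicative.ofAdd s))⁻¹ *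
      ((SemidirectProduct.inl (deltaF f) : Wreath ℤ F)⁻¹ * g)).right = -st.y ∧
      ∀ b ∉ Finset.Icc st.lo st.hi, ((SemidirectProduct.inr (Multiplicative.ofAdd s))⁻¹ *
      ((SemidirectProduct.inl (deltaF f) : Wreath ℤ F)⁻¹ * g)).left.1 (b - st.y) = 1) ↔
      ((Multiplicative.toAdd g.right = -(st.y - s) ∧
      ∀ b ∉ insert (st.y - s) (Finset.Icc st.lo st.hi), g.left.1 (b - (st.y - s)) = 1) ∧
      (st.y - s ∉ Finset.Icc st.lo st.hi → f = g.left.1 0)) := by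
    intro f
    rw [and_assoc]
    apply and_congr
    · simp; omega
    · have hv : ∀ b, ((SemidirectProduct.inr (Multiplicative.ofAdd s))⁻¹ *
        ((SemidirectProduct.inl (deltaF f) : Wreath ℤ F)⁻¹ * g)).left.1 (b - st.y) =
          (if b = st.y - s then f else 1)⁻¹ * g.left.1 (b - (st.y - s)) := by
        intro b
        rw [wr_mul_left, wr_inv_left, wr_mul_left, wr_inv_left]
        have e1 : b - st.y + s = b - (st.y - s) := by ring
        have e2 : (b - (st.y - s) = 0) = (b = st.y - s) := by rw [sub_eq_zero]
        simp [deltaF_apply, one_left_apply, e1, e2]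
      simp only [hv]
      constructor
      · intro h
        refine ⟨fun b hb => ?_, fun hb => ?_⟩
        · simp only [Finset.mem_insert, not_or] at hb
          simpa [hb.1] using h b hb.2
        · have := h _ hb
          simpa [inv_mul_eq_one] using this
      · rintro ⟨h1, h2⟩ b hb
        by_cases hbs : b = st.y - s
        · subst hbs
          simp [← h2 hb]
        · simpa [hbs] using h1 b (by simp [hbs]; simpa using hb)
  simp only [Uni, hcond, hI]
  have hy : (wstep s st).y = st.y - s := rfl
  rw [hy]
  by_cases hP : (Multiplicative.toAdd g.right = -(st.y - s) ∧
      ∀ b ∉ insert (st.y - s) (Finset.Icc st.lo st.hi), g.left.1 (b - (st.y - s)) = 1)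
  · rw [if_pos hP]
    by_cases hm : st.y - s ∈ Finset.Icc st.lo st.hi
    · rw [Finset.sum_congr rfl (fun f _ => by rw [if_pos ⟨hP, fun h => absurd hm h⟩]),
        Finset.insert_eq_of_mem hm, Finset.sum_const, Finset.card_univ, nsmul_eq_mul,
        mul_inv_cancel_left₀ hcard]
    · rw [Finset.sum_eq_single (g.left.1 0), if_pos ⟨hP, fun _ => rfl⟩,
        Finset.card_insert_of_notMem hm, pow_succ']
      · intro f _ hf
        rw [if_neg (fun h => hf (h.2 hm)), mul_zero]
      · intro h
        exact absurd (Finset.mem_univ _) h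
  · rw [if_neg hP]
    exact Finset.sum_eq_zero fun f _ => by rw [if_neg (fun h => hP h.1), mul_zero]

end WreathPart

lemma conv_rep {G : Type*} [Group G] [DecidableEq G] {ι : Type*} (t : Finset ι) (w : ι → ℝ) (e : ι → G)
    (μ Φ : G → ℝ) (hμ : ∀ g, μ g = ∑ i ∈ t, w i * (if g = e i then 1 else 0)) (g : G) :
    conv μ Φ g = ∑ i ∈ t, w i * Φ ((e i)⁻¹ * g) := by
  unfold conv
  simp only [hμ, Finset.sum_mul]
  refine HasSum.tsum_eq (hasSum_sum fun i _ => ?_)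
  have := hasSum_ite_eq (e i) (w i * Φ ((e i)⁻¹ * g))
  convert this using 1
  funext h
  split_ifs with hh
  · rw [hh, mul_one]
  · simp

section Rep
variable {F : Type*} [Group F] [Fintype F]

lemma deltaF_inj : Function.Injective (fun f : F => (SemidirectProduct.inl (deltaF f) : Wreath ℤ F)) := by
  intro f f' h
  have : ((SemidirectProduct.inl (deltaF f) : Wreath ℤ F)).left.1 0 =
    ((SemidirectProduct.inl (deltaF f') : Wreath ℤ F)).left.1 0 := by
    simp only at h
    rw [h]
  simpa [deltaF_apply] using this

lemma unifF_rep (g : Wreath ℤ F) : unifF ℤ F g = ∑ f : F, (Fintype.card F : ℝ)⁻¹ *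
    (if g = SemidirectProduct.inl (deltaF f) then 1 else 0) := by
  unfold unifF
  by_cases h : ∃ f : F, g = SemidirectProduct.inl (deltaF f)
  · rw [Set.indicator_of_mem (by exact h)]
    obtain ⟨f, rfl⟩ := h
    rw [Finset.sum_eq_single f]
    · simp
    · intro f' _ hf
      rw [if_neg (fun h => hf (deltaF_inj h).symm), mul_zero]
    · intro h
      exact absurd (Finset.mem_univ _) h
  · rw [Set.indicator_of_notMem (by exact h)]
    symm
    exact Finset.sum_eq_zero fun f _ => by rw [if_neg (fun h' => h ⟨f, h'⟩), mul_zero]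

lemma liftA_rep (ν : ℤ → ℝ) (hνsupp : Function.support ν = {-1, 0, 1}) (g : Wreath ℤ F) :
    liftA ν g = ∑ s ∈ stepSet, ν s *
    (if g = SemidirectProduct.inr (Multiplicative.ofAdd s) then 1 else 0) := by
  have hiff : ∀ s : ℤ, (g = SemidirectProduct.inr (Multiplicative.ofAdd s)) ↔
      (g.left = 1 ∧ Multiplicative.toAdd g.right = s) := by
    intro s
    constructor
    · rintro rfl; simp
    · rintro ⟨h1, h2⟩
      apply wr_ext
      · intro b; rw [h1]; rfl
      · simp [h2]
  unfold liftA
  simp only [hiff]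
  by_cases h : g.left = 1
  · simp only [h, if_true, true_and]
    by_cases hs : Multiplicative.toAdd g.right ∈ stepSet
    · rw [Finset.sum_eq_single_of_mem _ hs]
      · simp
      · intro b _ hb
        rw [if_neg (Ne.symm hb), mul_zero]
    · rw [Finset.sum_eq_zero]
      · by_contra h0
        have : Multiplicative.toAdd g.right ∈ Function.support ν := h0
        rw [hνsupp] at this
        exact hs (by simpa [stepSet] using this)
      · intro s hs'
        rw [if_neg, mul_zero]
        rintro rfl
        exact hs hs'
  · simp [h]

lemma conv_rep_rep {G : Type*} [Group G] [DecidableEq G] {ι κ : Type*} (t : Finset ι) (w : ι → ℝ) (e : ι → G)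
    (t' : Finset κ) (w' : κ → ℝ) (e' : κ → G)
    (μ μ' : G → ℝ) (hμ : ∀ g, μ g = ∑ i ∈ t, w i * (if g = e i then 1 else 0))
    (hμ' : ∀ g, μ' g = ∑ i ∈ t', w' i * (if g = e' i then 1 else 0)) (g : G) :
    conv μ μ' g = ∑ x ∈ t ×ˢ t', (w x.1 * w' x.2) * (if g = e x.1 * e' x.2 then 1 else 0) := by
  rw [conv_rep t w e μ μ' hμ, Finset.sum_product]
  refine Finset.sum_congr rfl fun i _ => ?_
  rw [hμ', Finset.mul_sum]
  refine Finset.sum_congr rfl fun j _ => ?_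
  simp only [inv_mul_eq_iff_eq_mul]
  ring

lemma conv_sws (ν : ℤ → ℝ) (hνsupp : Function.support ν = {-1, 0, 1}) (Φ : Wreath ℤ F → ℝ)
    (g : Wreath ℤ F) :
    conv (swsMeasure ν) Φ g = ∑ s ∈ stepSet, ν s * ∑ f : F, (Fintype.card F : ℝ)⁻¹ *
      conv (unifF ℤ F) Φ ((SemidirectProduct.inr (Multiplicative.ofAdd s))⁻¹ *
      ((SemidirectProduct.inl (deltaF f))⁻¹ * g)) := by
  have h1 := conv_rep_rep _ _ _ _ _ _ _ _ (liftA_rep (F := F) ν hνsupp) (unifF_rep (F := F))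
  have h2 := conv_rep_rep _ _ _ _ _ _ _ _ (unifF_rep (F := F)) h1
  have h3 := conv_rep _ _ _ (swsMeasure ν) Φ h2 g
  rw [h3]
  simp only [conv_rep _ _ _ (unifF ℤ F) Φ unifF_rep, Finset.sum_product]
  rw [Finset.sum_comm]
  refine Finset.sum_congr rfl fun s _ => ?_
  rw [Finset.mul_sum]
  refine Finset.sum_congr rfl fun f _ => ?_
  rw [Finset.mul_sum, Finset.mul_sum]
  refine Finset.sum_congr rfl fun f' _ => ?_
  simp only [mul_inv_rev, mul_assoc]
  ring

lemma Uni_init (g : Wreath ℤ F) : unifF ℤ F g = Uni F winit g := by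
  unfold unifF Uni
  by_cases h : ∃ f : F, g = SemidirectProduct.inl (deltaF f)
  · rw [Set.indicator_of_mem (by exact h), if_pos]
    · simp [winit]
    · obtain ⟨f, rfl⟩ := h
      refine ⟨by simp [winit], fun b hb => ?_⟩
      have : b ≠ 0 := by rintro rfl; simp [winit] at hb
      simp [deltaF_apply, winit, this]
  · rw [Set.indicator_of_notMem (by exact h), if_neg]
    rintro ⟨h1, h2⟩
    apply h
    refine ⟨g.left.1 0, wr_ext (fun b => ?_) ?_⟩
    · by_cases hb : b = 0
      · subst hb; simp [deltaF_apply]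
      · have := h2 b (by simp [winit]; omega)
        simp [winit] at this
        simp [deltaF_apply, hb, this]
    · simpa [winit] using h1

lemma conv_unif_Q (ν : ℤ → ℝ) (n : ℕ) (g : Wreath ℤ F) :
    conv (unifF ℤ F) (fun g => (Qop ν)^[n] (fun st => Uni F st g) winit) g =
      (Qop ν)^[n] (fun st => Uni F st g) winit := by
  rw [conv_rep _ _ _ (unifF ℤ F) _ unifF_rep]
  simp only [Uni_delta]
  have hcard : (Fintype.card F : ℝ) ≠ 0 := by
    exact_mod_cast Fintype.card_ne_zero
  rw [Finset.sum_const, Finset.card_univ, nsmul_eq_mul, mul_inv_cancel_left₀ hcard]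

lemma convPow_rep (ν : ℤ → ℝ) (hνsupp : Function.support ν = {-1, 0, 1}) (n : ℕ) :
    convPow (swsMeasure (F := F) ν) (n + 1) =
      fun g => (Qop ν)^[n + 1] (fun st => Uni F st g) winit := by
  have key : ∀ n, conv (unifF ℤ F) (convPow (swsMeasure (F := F) ν) n) =
        (fun g => (Qop ν)^[n] (fun st => Uni F st g) winit) →
      convPow (swsMeasure (F := F) ν) (n + 1) =
      fun g => (Qop ν)^[n + 1] (fun st => Uni F st g) winit := by
    intro n hn
    funext g
    change conv _ _ g = _
    rw [conv_sws ν hνsupp, hn, Function.iterate_succ_apply]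
    simp only [← Qop_sum]
    refine congrFun (congrArg _ ?_) winit
    funext st
    unfold Qop
    exact Finset.sum_congr rfl fun s hs => by rw [Uni_step st s hs]
  apply key
  induction n with
  | zero =>
    funext g
    rw [conv_rep _ _ _ (unifF ℤ F) _ unifF_rep]
    simp only [Function.iterate_zero, id]
    rw [← Uni_init, unifF_rep]
    refine Finset.sum_congr rfl fun f _ => ?_
    have e : ((SemidirectProduct.inl (deltaF f))⁻¹ * g = 1) ↔ g = SemidirectProduct.inl (deltaF f) := by
      rw [inv_mul_eq_one, eq_comm]
    simp only [convPow, e]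
  | succ n ih =>
    rw [key n ih]
    funext g
    exact conv_unif_Q ν (n+1) g

lemma count_fun (I J : Finset ℤ) (hJ : J ⊆ I) :
    ∑ φ : I → F, ((Fintype.card F : ℝ)⁻¹) ^ I.card * (if ∀ i : I, i.1 ∈ J → φ i = 1 then 1 else 0)
      = ((Fintype.card F : ℝ)⁻¹) ^ J.card := by
  set r : ℝ := (Fintype.card F : ℝ)⁻¹
  have hcard : (Fintype.card F : ℝ) ≠ 0 := by
    exact_mod_cast Fintype.card_ne_zero
  have h1 : ∀ φ : I → F, r ^ I.card * (if ∀ i : I, i.1 ∈ J → φ i = 1 then (1:ℝ) else 0) =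
      ∏ i : I, (r * (if i.1 ∈ J → φ i = 1 then 1 else 0)) := by
    intro φ
    rw [Finset.prod_mul_distrib, Finset.prod_const, Finset.card_univ, Fintype.card_coe]
    congr 1
    split_ifs with h
    · symm; exact Finset.prod_eq_one fun i _ => if_pos (h i)
    · push Not at h
      obtain ⟨i, hi, hi'⟩ := h
      symm
      exact Finset.prod_eq_zero (Finset.mem_univ i) (if_neg (fun h => hi' (h hi)))
  have h2 : ∀ i : I, ∑ f : F, (r * (if i.1 ∈ J → f = 1 then 1 else 0)) =
      if i.1 ∈ J then r else 1 := by
    intro i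
    by_cases h : i.1 ∈ J
    · simp [h]
    · simp [h, r, hcard]
  simp only [h1]
  have h3 := Finset.prod_univ_sum (fun _ : I => (Finset.univ : Finset F))
    (fun (i : I) (f : F) => r * (if i.1 ∈ J → f = 1 then (1:ℝ) else 0))
  rw [Fintype.piFinset_univ] at h3
  rw [← h3]
  simp only [h2]
  rw [Finset.prod_coe_sort I (fun i => if i ∈ J then r else 1), Finset.prod_ite,
    Finset.prod_const, Finset.prod_const_one, mul_one, Finset.filter_mem_eq_inter,
    Finset.inter_eq_right.2 hJ]

def embW (st : WSt) (φ : Finset.Icc st.lo st.hi → F) : Wreath ℤ F :=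
  ⟨⟨fun b => if h : b + st.y ∈ Finset.Icc st.lo st.hi then φ ⟨b + st.y, h⟩ else 1, by
    refine (Set.finite_Icc (st.lo - st.y) (st.hi - st.y)).subset ?_
    intro b hb
    simp only [Function.mem_mulSupport] at hb
    by_contra h
    apply hb
    rw [dif_neg]
    simp only [Set.mem_Icc, Finset.mem_Icc] at *
    omega⟩, Multiplicative.ofAdd (-st.y)⟩

lemma embW_left (st : WSt) (φ : Finset.Icc st.lo st.hi → F) (b : ℤ) (h : b ∈ Finset.Icc st.lo st.hi) :
    (embW st φ).left.1 (b - st.y) = φ ⟨b, h⟩ := by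
  have : b - st.y + st.y = b := by ring
  simp only [embW, this, dif_pos h]

lemma embW_left' (st : WSt) (φ : Finset.Icc st.lo st.hi → F) (b : ℤ) (h : b ∉ Finset.Icc st.lo st.hi) :
    (embW st φ).left.1 (b - st.y) = 1 := by
  have : b - st.y + st.y = b := by ring
  simp only [embW, this, dif_neg h]

lemma embW_right (st : WSt) (φ : Finset.Icc st.lo st.hi → F) :
    Multiplicative.toAdd (embW st φ).right = - st.y := rfl

lemma Uni_rep (st : WSt) (g : Wreath ℤ F) : Uni F st g = ∑ φ : Finset.Icc st.lo st.hi → F,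
    ((Fintype.card F : ℝ)⁻¹) ^ (Finset.Icc st.lo st.hi).card * (if g = embW st φ then 1 else 0) := by
  have hinj : ∀ φ φ' : Finset.Icc st.lo st.hi → F, embW st φ = embW st φ' → φ = φ' := by
    intro φ φ' h
    funext i
    rw [← embW_left st φ i.1 i.2, ← embW_left st φ' i.1 i.2, h]
  unfold Uni
  split_ifs with h
  · obtain ⟨h1, h2⟩ := h
    have : g = embW st (fun i => g.left.1 (i.1 - st.y)) := by
      apply wr_ext
      · intro b
        have e : b = (b + st.y) - st.y := by ring
        rw [e]
        by_cases hb : b + st.y ∈ Finset.Icc st.lo st.hi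
        · rw [embW_left st _ _ hb]
        · rw [embW_left' st _ _ hb, h2 _ hb]
      · rw [h1, embW_right]
    rw [Finset.sum_eq_single (fun i => g.left.1 (i.1 - st.y)), if_pos this, mul_one]
    · intro φ _ hφ
      rw [if_neg, mul_zero]
      intro h
      exact hφ (hinj _ _ (h.symm.trans this))
    · intro h
      exact absurd (Finset.mem_univ _) h
  · symm
    refine Finset.sum_eq_zero fun φ _ => ?_
    rw [if_neg, mul_zero]
    rintro rfl
    exact h ⟨rfl, fun b hb => embW_left' st φ b hb⟩

/-- The good set. -/
def goodV (F : Type*) [Group F] (L : ℕ) : Set (Wreath ℤ F) :=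
  {h | (∃ b : ℤ, L < b ∧ h.left.1 (b + Multiplicative.toAdd h.right) ≠ 1) ∧
    (∃ b : ℤ, b < -L ∧ h.left.1 (b + Multiplicative.toAdd h.right) ≠ 1)}

lemma Uni_V (L K : ℕ) (st : WSt) : ∃ k : ℝ, HasSum (fun x : goodV F L => Uni F st x) k ∧
    ((1 - 2 * ((Fintype.card F : ℝ)⁻¹) ^ K) - (if st.hi < ((L + K : ℕ) : ℤ) then 1 else 0))
      - (if -st.lo < ((L + K : ℕ) : ℤ) then 1 else 0) ≤ k := by
  set r : ℝ := (Fintype.card F : ℝ)⁻¹ with hr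
  have hr0 : 0 ≤ r := by positivity
  refine ⟨∑ φ : Finset.Icc st.lo st.hi → F, r ^ (Finset.Icc st.lo st.hi).card *
    (if embW st φ ∈ goodV F L then 1 else 0), ?_, ?_⟩
  · simp only [Uni_rep]
    refine hasSum_sum fun φ _ => HasSum.mul_left _ ?_
    by_cases h : embW st φ ∈ goodV F L
    · rw [if_pos h]
      have := hasSum_ite_eq (⟨_, h⟩ : goodV F L) (1:ℝ)
      simpa only [Subtype.ext_iff] using this
    · rw [if_neg h]
      have : (fun x : goodV F L => if x.1 = embW st φ then (1:ℝ) else 0) = fun _ => 0 := by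
        funext x
        rw [if_neg]
        intro hx
        exact h (hx ▸ x.2)
      rw [this]
      exact hasSum_zero
  · have hk0 : 0 ≤ ∑ φ : Finset.Icc st.lo st.hi → F, r ^ (Finset.Icc st.lo st.hi).card *
      (if embW st φ ∈ goodV F L then (1:ℝ) else 0) :=
      Finset.sum_nonneg fun φ _ => mul_nonneg (by positivity) (by split_ifs <;> norm_num)
    have hrK : 0 ≤ r ^ K := by positivity
    by_cases hhi : st.hi < ((L + K : ℕ) : ℤ)
    · rw [if_pos hhi]
      split_ifs <;> linarith
    by_cases hlo : -st.lo < ((L + K : ℕ) : ℤ)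
    · rw [if_pos hlo]
      split_ifs <;> linarith
    rw [if_neg hhi, if_neg hlo, sub_zero, sub_zero]
    push_cast at hhi hlo
    set I := Finset.Icc st.lo st.hi
    have c0 := count_fun (F := F) I ∅ (Finset.empty_subset _)
    have c1 := count_fun (F := F) I (Finset.Ioc (L:ℤ) (L+K))
      (by intro b; simp only [I, Finset.mem_Icc, Finset.mem_Ioc]; omega)
    have c2 := count_fun (F := F) I (Finset.Ico (-(L+K:ℤ)) (-L))
      (by intro b; simp only [I, Finset.mem_Icc, Finset.mem_Ico]; omega)
    have k1 : (Finset.Ioc (L:ℤ) (L+K)).card = K := by simp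
    have k2 : (Finset.Ico (-(L+K:ℤ)) (-L)).card = K := by simp
    rw [k1] at c1
    rw [k2] at c2
    rw [Finset.card_empty, pow_zero] at c0
    rw [← hr] at c0 c1 c2
    have hsplit : 1 - 2 * r ^ K = ∑ φ : I → F,
        (r ^ I.card * (if ∀ i : I, i.1 ∈ (∅ : Finset ℤ) → φ i = 1 then (1:ℝ) else 0) -
        r ^ I.card * (if ∀ i : I, i.1 ∈ Finset.Ioc (L:ℤ) (L+K) → φ i = 1 then (1:ℝ) else 0) -
        r ^ I.card * (if ∀ i : I, i.1 ∈ Finset.Ico (-(L+K:ℤ)) (-L) → φ i = 1 then (1:ℝ) else 0)) := by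
      rw [Finset.sum_sub_distrib, Finset.sum_sub_distrib, c0, c1, c2]
      ring
    rw [hsplit]
    refine Finset.sum_le_sum fun φ _ => ?_
    rw [← mul_sub, ← mul_sub]
    refine mul_le_mul_of_nonneg_left ?_ (by positivity)
    by_cases hg : embW st φ ∈ goodV F L
    · rw [if_pos hg]
      split_ifs <;> norm_num
    · rw [if_neg hg]
      have : (∀ i : I, i.1 ∈ Finset.Ioc (L:ℤ) (L+K) → φ i = 1) ∨
          (∀ i : I, i.1 ∈ Finset.Ico (-(L+K:ℤ)) (-L) → φ i = 1) := by
        by_contra hc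
        push Not at hc
        obtain ⟨⟨i, hi, hi'⟩, ⟨j, hj, hj'⟩⟩ := hc
        apply hg
        rw [Finset.mem_Ioc] at hi
        rw [Finset.mem_Ico] at hj
        refine ⟨⟨i.1, hi.1, ?_⟩, ⟨j.1, hj.2, ?_⟩⟩
        · rw [embW_right, ← sub_eq_add_neg, embW_left st φ i.1 i.2]; exact hi'
        · rw [embW_right, ← sub_eq_add_neg, embW_left st φ j.1 j.2]; exact hj'
      rcases this with h | h
      · rw [if_pos h]; split_ifs <;> norm_num
      · rw [if_pos h]; split_ifs <;> norm_num

lemma Uni_inv (L : ℕ) (st : WSt) (h g : Wreath ℤ F) (hh : h ∈ goodV F L) (hg : g.right = 1)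
    (hgL : ∀ b, g.left.1 b ≠ 1 → |b| ≤ L) : Uni F st (h * g) = Uni F st h := by
  obtain ⟨⟨a, ha, ha'⟩, ⟨c, hc, hc'⟩⟩ := hh
  set x := Multiplicative.toAdd h.right with hx
  have hval : ∀ b : ℤ, b < -(L:ℤ) ∨ (L:ℤ) < b → (h * g).left.1 (b + x) = h.left.1 (b + x) := by
    intro b hb
    rw [wr_mul_left, ← hx]
    have : g.left.1 (b + x - x) = 1 := by
      by_contra hne
      have := hgL _ hne
      rw [abs_le] at this
      omega
    rw [this, mul_one]
  have hr : (h * g).right = h.right := by rw [SemidirectProduct.mul_right, hg, mul_one]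
  have aux : ∀ f : ℤ → F, f (a + x) ≠ 1 → f (c + x) ≠ 1 → x = -st.y →
      (∀ b ∉ Finset.Icc st.lo st.hi, f (b - st.y) = 1) →
      st.lo ≤ c ∧ a ≤ st.hi := by
    intro f h1 h2 hxy hf
    constructor
    · by_contra hlt
      refine h2 ?_
      rw [hxy, ← sub_eq_add_neg]
      refine hf c ?_
      simp only [Finset.mem_Icc]; omega
    · by_contra hlt
      refine h1 ?_
      rw [hxy, ← sub_eq_add_neg]
      refine hf a ?_
      simp only [Finset.mem_Icc]; omega
  have hiff : (Multiplicative.toAdd (h * g).right = -st.y ∧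
      ∀ b ∉ Finset.Icc st.lo st.hi, (h * g).left.1 (b - st.y) = 1) ↔
      (Multiplicative.toAdd h.right = -st.y ∧
      ∀ b ∉ Finset.Icc st.lo st.hi, h.left.1 (b - st.y) = 1) := by
    rw [hr, ← hx]
    refine and_congr_right fun hxy => ?_
    have hv' : ∀ b : ℤ, b < -(L:ℤ) ∨ (L:ℤ) < b → (h * g).left.1 (b - st.y) = h.left.1 (b - st.y) := by
      intro b hb
      have := hval b hb
      rwa [hxy, ← sub_eq_add_neg] at this
    constructor
    · intro hf b hb
      have := aux (fun b => (h * g).left.1 b) (by rw [hval a (Or.inr ha)]; exact ha')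
        (by rw [hval c (Or.inl hc)]; exact hc') hxy hf
      rw [← hv' b (by simp only [Finset.mem_Icc] at hb; omega)]
      exact hf b hb
    · intro hf b hb
      have := aux (fun b => h.left.1 b) ha' hc' hxy hf
      rw [hv' b (by simp only [Finset.mem_Icc] at hb; omega)]
      exact hf b hb
  simp only [Uni, hiff]

end Rep

/-- (Theorem 1, part 2: invariance.) Let `G = ℤ ≀ F` with `F` a finite
group with at least two elements, `μ` the standard simple switch-walk-switch measure, and
`G₀ = ⊕_ℤ F` the subgroup of elements with trivial `ℤ`-coordinate. For every `ε > 0` there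
exists `c > 0` such that for all sufficiently large `n` there is a set `Vₙ` with
`μ^{*n}(Vₙ) ≥ 1 - ε` on which `μ^{*n}(h g) = μ^{*n}(h)` for all `g ∈ G₀` of word length at
most `c √n`. -/
theorem stmt12 (F : Type*) [Group F] [Fintype F] [Nontrivial F]
    (ν : ℤ → ℝ) (hν0 : ∀ z, 0 ≤ ν z) (hν1 : HasSum ν 1)
    (hνsym : ∀ z : ℤ, ν z = ν (-z))
    (hνsupp : Function.support ν = {-1, 0, 1}) :
    ∀ ε > (0 : ℝ), ∃ c > (0 : ℝ), ∃ N : ℕ, ∀ n ≥ N, ∃ V : Set (Wreath ℤ F),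
      1 - ε ≤ measOf (convPow (swsMeasure ν) n) V ∧
      ∀ h ∈ V, ∀ g : Wreath ℤ F, g.right = 1 →
        (wordLength (stdGenZ F) g : ℝ) ≤ c * Real.sqrt n →
        convPow (swsMeasure ν) n (h * g) = convPow (swsMeasure ν) n h := by
  intro ε hε
  set p := ν 1 with hp
  have hp0 : 0 < p := by
    have h : (1 : ℤ) ∈ Function.support ν := by rw [hνsupp]; simp
    exact lt_of_le_of_ne (hν0 1) (Ne.symm h)
  have hsym : ν (-1) = ν 1 := (hνsym 1).symm
  have hsum : ∑ s ∈ stepSet, ν s = 1 := by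
    refine (hasSum_sum_of_ne_finset_zero ?_).unique hν1
    intro b hb
    by_contra h0
    have : b ∈ Function.support ν := h0
    rw [hνsupp] at this
    exact hb (by simpa [stepSet] using this)
  set r : ℝ := (Fintype.card F : ℝ)⁻¹ with hr
  have hr0 : 0 ≤ r := by positivity
  have hr1 : r < 1 := by
    apply inv_lt_one_of_one_lt₀
    exact_mod_cast Fintype.one_lt_card
  set η := ε / 8 with hη
  have hη0 : 0 < η := by positivity
  obtain ⟨K, hK⟩ := exists_pow_lt_of_lt_one hη0 hr1
  obtain ⟨B, hB0, hB⟩ : ∃ B : ℝ, 0 < B ∧ (1 + p * (B ^ 2 / 2))⁻¹ ≤ η := by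
    refine ⟨Real.sqrt (2 / (p * η)), Real.sqrt_pos.2 (by positivity), ?_⟩
    rw [Real.sq_sqrt (by positivity)]
    have : p * (2 / (p * η) / 2) = η⁻¹ := by field_simp
    rw [this]
    rw [inv_le_comm₀ (by positivity) hη0]
    linarith
  refine ⟨η / B, by positivity, ⌈(B * K / η) ^ 2⌉₊ + 1, fun n hn => ?_⟩
  have hn1 : (1 : ℝ) ≤ n := by exact_mod_cast (by omega : 1 ≤ n)
  have hn0 : (0 : ℝ) < n := by linarith
  have hsq : 0 < Real.sqrt n := Real.sqrt_pos.2 hn0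
  have hBK : B * K / η ≤ Real.sqrt n := by
    apply Real.le_sqrt_of_sq_le
    refine (Nat.le_ceil _).trans ?_
    exact_mod_cast (by omega : ⌈(B * K / η) ^ 2⌉₊ ≤ n)
  set L := ⌊η / B * Real.sqrt n⌋₊ with hL
  have hLle : (L : ℝ) ≤ η / B * Real.sqrt n := Nat.floor_le (by positivity)
  set θ := B / Real.sqrt n with hθ
  have hθ0 : 0 ≤ θ := by positivity
  have hbound : θ * ((L + K : ℕ) : ℝ) + (1 + n * (ν 1 * (θ ^ 2 / 2)))⁻¹ ≤ 3 * η := by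
    have e1 : n * (ν 1 * (θ ^ 2 / 2)) = p * (B ^ 2 / 2) := by
      rw [hθ, div_pow, Real.sq_sqrt hn0.le, ← hp]
      field_simp
    rw [e1]
    have e2 : θ * L ≤ η := by
      calc θ * L ≤ θ * (η / B * Real.sqrt n) := mul_le_mul_of_nonneg_left hLle hθ0
        _ = η := by rw [hθ]; field_simp
    have e3 : θ * K ≤ η := by
      rw [hθ, div_mul_eq_mul_div, div_le_iff₀ hsq]
      rw [div_le_iff₀ hη0] at hBK
      linarith
    push_cast
    linarith
  obtain ⟨n', rfl⟩ : ∃ n', n = n' + 1 := ⟨n - 1, by omega⟩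
  rw [convPow_rep ν hνsupp n']
  set n := n' + 1
  refine ⟨goodV F L, ?_, ?_⟩
  · choose k hk1 hk2 using fun st => Uni_V (F := F) L K st
    have hs := Qop_hasSum (ν := ν) (fun st (x : goodV F L) => Uni F st x) k hk1 n winit
    have hm : measOf (fun g => (Qop ν)^[n] (fun st => Uni F st g) winit) (goodV F L) =
        (Qop ν)^[n] k winit := hs.tsum_eq
    rw [hm]
    have hmono := Qop_mono hν0 hk2 n winit
    rw [Qop_sub, Qop_sub, Qop_const hsum] at hmono
    have b1 := Qop_hit' hν0 hsum hsym (fun st => st.hi < ((L + K : ℕ) : ℤ)) (fun st => st.y)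
      (L + K) (-1) (Or.inr rfl) (by intro s st; simp [wstep]; ring)
      (by intro s st h; simp only [wstep] at h; omega)
      (by intro st h; have := st.h2; omega) rfl θ hθ0 n
    have b2 := Qop_hit' hν0 hsum hsym (fun st => -st.lo < ((L + K : ℕ) : ℤ)) (fun st => -st.y)
      (L + K) 1 (Or.inl rfl) (by intro s st; simp [wstep]; ring)
      (by intro s st h; simp only [wstep] at h; omega)
      (by intro st h; have := st.h1; omega) rfl θ hθ0 n
    linarith
  · intro h hh g hg hgl
    have hwl : wordLength (stdGenZ F) g ≤ L := Nat.le_floor hgl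
    simp only
    refine congrFun (congrArg _ ?_) winit
    funext st
    refine Uni_inv L st h g hh hg fun b hb => (wl_supp g b hb).trans ?_
    exact_mod_cast hwl
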